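/- arXiv:2011.08603 — 2 statements merged into one kernel-verified Lean document; each statement's English description precedes it below -/
import Mathlib

section
/- Let n ≥ 1 and let I, J be permutations of {1,…,n}. If the elliptic weight function W_I(t,w,ħ,μ) is evaluated at t = w_J (i.e. t^{(k)}_a = w_{j^{(k)}_a} for all 1 ≤ k ≤ n−1, 1 ≤ a ≤ k, where j^{(k)}_1 < ⋯ < j^{(k)}_k orders {J_1,…,J_k}), then the result is 0 unless I ≺ J, where I ≺ J means i^{(k)}_m ≤ j^{(k)}_m for all 1 ≤ k ≤ n−1 and 1 ≤ m ≤ k. -/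
noncomputable section
open scoped BigOperators

/-- `φ(x) = ∏_{i=0}^∞ (1 − x qⁱ)`. -/
def phiP (q x : ℂ) : ℂ := ∏' i : ℕ, (1 - x * q ^ i)

/-- The odd Jacobi theta function `ϑ(x) = (x^{1/2} − x^{−1/2}) φ(qx) φ(q/x)`,
expressed in terms of the chosen square root `y = x^{1/2}` of `x = y²`. -/
def thetaH (q y : ℂ) : ℂ := (y - y⁻¹) * phiP q (q * y ^ 2) * phiP q (q / y ^ 2)
/-- The (0-based) value `I_{k+1} - 1` of a permutation `I` of `{1,…,n}` at the
(0-based) position `k`; junk value `0` if `k ≥ n`. -/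
def pval (n : ℕ) (I : Equiv.Perm (Fin n)) (k : ℕ) : ℕ :=
  if h : k < n then ((I ⟨k, h⟩ : Fin n) : ℕ) else 0

/-- The `a`-th smallest (0-based position `a`) element of `{I_1,…,I_k}`, with all
values recorded 0-based: this is `i^{(k)}_{a+1} - 1` in the notation of the paper. -/
def ordIdx (n : ℕ) (I : Equiv.Perm (Fin n)) (k a : ℕ) : ℕ :=
  (((Finset.range k).image (pval n I)).sort (· ≤ ·)).getD a 0

/-- `j(I,k,a)`: the 0-based position `j` with `I_j = i^{(k)}_a`. -/
def jIdx (n : ℕ) (I : Equiv.Perm (Fin n)) (k a : ℕ) : ℕ :=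
  if h : ordIdx n I k a < n then ((I.symm ⟨ordIdx n I k a, h⟩ : Fin n) : ℕ) else 0

/-- The set of pairs `(j,k)` of 0-based indices with `0 ≤ j < k ≤ n-1`. -/
def pairsN (n : ℕ) : Finset (ℕ × ℕ) :=
  (Finset.range n ×ˢ Finset.range n).filter (fun p => p.1 < p.2)

/-- The order `I ≺ J`:  `i^{(k)}_m ≤ j^{(k)}_m` for all `1 ≤ k ≤ n-1`, `1 ≤ m ≤ k`. -/
def prec (n : ℕ) (I J : Equiv.Perm (Fin n)) : Prop :=
  ∀ k, 1 ≤ k → k ≤ n - 1 → ∀ m, m < k → ordIdx n I k m ≤ ordIdx n J k m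
/-- The factor `ψ_{I,k,a,c}(x)` of the elliptic weight function, expressed in terms of
the chosen square root `y` of the argument `x`.  Here `k` is the 1-based level
(`1 ≤ k ≤ n-1`) and `a, c` are 0-based positions; `sμ j` is the chosen square root of
`μ_{j+1}`, `sh` that of `ħ`. -/
def psiF (n : ℕ) (I : Equiv.Perm (Fin n)) (q sh : ℂ) (sμ : ℕ → ℂ) (k a c : ℕ) (y : ℂ) : ℂ :=
  if ordIdx n I (k + 1) c < ordIdx n I k a then thetaH q y
  else if ordIdx n I (k + 1) c = ordIdx n I k a then
    thetaH q (y * (if pval n I k < ordIdx n I k a then sh⁻¹ else 1) *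
        sμ (jIdx n I k a) / sμ k) /
      thetaH q ((if pval n I k < ordIdx n I k a then sh⁻¹ else 1) *
        sμ (jIdx n I k a) / sμ k)
  else thetaH q (y / sh)

/-- The chosen square root of the variable `t^{(k)}_{a+1}` (1-based level `1 ≤ k ≤ n`,
0-based position `a`), with the convention `t^{(n)}_j = w_j`. -/
def tvF (n : ℕ) (sw : ℕ → ℂ) (st : ℕ → ℕ → ℂ) (k a : ℕ) : ℂ :=
  if k = n then sw a else st k a

/-- The function `U_I(t,w,ħ,μ)`, in terms of the chosen square roots of all parameters. -/
def UF (n : ℕ) (I : Equiv.Perm (Fin n)) (q sh : ℂ) (sμ sw : ℕ → ℂ) (st : ℕ → ℕ → ℂ) : ℂ :=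
  ∏ k ∈ Finset.Icc 1 (n - 1),
    ((∏ a ∈ Finset.range k, ∏ c ∈ Finset.range (k + 1),
        psiF n I q sh sμ k a c (tvF n sw st (k + 1) c / tvF n sw st k a)) *
      ∏ a ∈ Finset.range k, ∏ b ∈ Finset.Ioo a k,
        thetaH q (sh * tvF n sw st k b / tvF n sw st k a) /
          thetaH q (tvF n sw st k b / tvF n sw st k a))

/-- `E(t,ħ) = ∏_{k=1}^{n-1} ∏_{a,b=1}^{k} ϑ(ħ t^{(k)}_b/t^{(k)}_a)`. -/
def EF (n : ℕ) (q sh : ℂ) (sw : ℕ → ℂ) (st : ℕ → ℕ → ℂ) : ℂ :=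
  ∏ k ∈ Finset.Icc 1 (n - 1), ∏ a ∈ Finset.range k, ∏ b ∈ Finset.range k,
    thetaH q (sh * tvF n sw st k b / tvF n sw st k a)

/-- The action on the variables `t^{(k)}_a` of a tuple `π` of permutations, one for each
level `k`: the `k`-th permutation permutes `t^{(k)}_1, …, t^{(k)}_k`. -/
def permSt (n : ℕ) (π : (k : Fin n) → Equiv.Perm (Fin (k : ℕ))) (st : ℕ → ℕ → ℂ) :
    ℕ → ℕ → ℂ := fun k a =>
  if hk : k < n then (if ha : a < k then st k ((π ⟨k, hk⟩) ⟨a, ha⟩ : Fin k) else st k a)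
  else st k a

/-- The elliptic weight function
`W_I = ϑ(ħ⁻¹)^{n(n-1)/2} Sym_{t^{(1)}} ⋯ Sym_{t^{(n-1)}} U_I`. -/
def WF (n : ℕ) (I : Equiv.Perm (Fin n)) (q sh : ℂ) (sμ sw : ℕ → ℂ) (st : ℕ → ℕ → ℂ) : ℂ :=
  thetaH q sh⁻¹ ^ (n * (n - 1) / 2) *
    ∑ π : (k : Fin n) → Equiv.Perm (Fin (k : ℕ)), UF n I q sh sμ sw (permSt n π st)

lemma tri_pval_lt {n : ℕ} (I : Equiv.Perm (Fin n)) {k : ℕ} (hk : k < n) : pval n I k < n := by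
  simp [pval, hk]

lemma tri_card {n : ℕ} (I : Equiv.Perm (Fin n)) {k : ℕ} (hk : k ≤ n) :
    ((Finset.range k).image (pval n I)).card = k := by
  rw [Finset.card_image_of_injOn, Finset.card_range]
  intro a ha b hb hab
  simp only [Finset.coe_range, Set.mem_Iio] at ha hb
  have ha' : a < n := by omega
  have hb' : b < n := by omega
  simp only [pval, ha', hb', dif_pos] at hab
  have := I.injective (Fin.ext hab)
  simpa using this

lemma tri_ordIdx_eq {n : ℕ} (I : Equiv.Perm (Fin n)) {k a : ℕ} (hk : k ≤ n) (ha : a < k) :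
    ordIdx n I k a =
      ((Finset.range k).image (pval n I)).orderEmbOfFin (tri_card I hk) ⟨a, ha⟩ := by
  unfold ordIdx
  rw [Finset.orderEmbOfFin_apply, List.getD_eq_getElem _ _ (by rw [Finset.length_sort, tri_card I hk]; exact ha)]
  rfl

lemma tri_lt {n : ℕ} (I : Equiv.Perm (Fin n)) {k a b : ℕ} (hk : k ≤ n) (hab : a < b)
    (hb : b < k) : ordIdx n I k a < ordIdx n I k b := by
  rw [tri_ordIdx_eq I hk (hab.trans hb), tri_ordIdx_eq I hk hb]
  exact (OrderEmbedding.strictMono _) (by simpa using hab)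

lemma tri_mem {n : ℕ} (I : Equiv.Perm (Fin n)) {k a : ℕ} (hk : k ≤ n) (ha : a < k) :
    ordIdx n I k a ∈ (Finset.range k).image (pval n I) := by
  rw [tri_ordIdx_eq I hk ha]
  exact Finset.orderEmbOfFin_mem _ _ _

lemma tri_surj {n : ℕ} (I : Equiv.Perm (Fin n)) {k x : ℕ} (hk : k ≤ n)
    (hx : x ∈ (Finset.range k).image (pval n I)) : ∃ a, a < k ∧ ordIdx n I k a = x := by
  have h := Finset.range_orderEmbOfFin _ (tri_card I hk)
  have hx' : x ∈ Set.range (((Finset.range k).image (pval n I)).orderEmbOfFin (tri_card I hk)) := by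
    rw [h]; exact_mod_cast hx
  obtain ⟨a, rfl⟩ := hx'
  exact ⟨a, a.2, tri_ordIdx_eq I hk a.2⟩

lemma tri_bound {n : ℕ} (I : Equiv.Perm (Fin n)) {k a : ℕ} (hk : k ≤ n) (ha : a < k) :
    ordIdx n I k a < n := by
  have := tri_mem I hk ha
  simp only [Finset.mem_image, Finset.mem_range] at this
  obtain ⟨b, hb, h⟩ := this
  rw [← h]
  exact tri_pval_lt I (by omega)

lemma tri_top {n : ℕ} (I : Equiv.Perm (Fin n)) (d a : ℕ) (ha : a + d + 1 = n) :
    ordIdx n I n a ≤ a := by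
  induction d generalizing a with
  | zero => have := tri_bound I le_rfl (show a < n by omega); omega
  | succ d ih =>
    have h1 := ih (a + 1) (by omega)
    have h2 := tri_lt I le_rfl (show a < a + 1 by omega) (show a + 1 < n by omega)
    omega

/-- Index of the `w`-variable substituted for `t^{(k)}_a`. -/
def triG (n : ℕ) (J : Equiv.Perm (Fin n)) (π : (k : Fin n) → Equiv.Perm (Fin (k : ℕ)))
    (k a : ℕ) : ℕ :=
  if hk : k < n then (if ha : a < k then ordIdx n J k ((π ⟨k, hk⟩) ⟨a, ha⟩ : Fin k) else 0)
  else a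

lemma tri_tv {n : ℕ} (J : Equiv.Perm (Fin n)) (π : (k : Fin n) → Equiv.Perm (Fin (k : ℕ)))
    (sw : ℕ → ℂ) {k a : ℕ} (hk : k ≤ n) (ha : a < k) :
    tvF n sw (permSt n π (fun k a => sw (ordIdx n J k a))) k a = sw (triG n J π k a) := by
  rcases Nat.lt_or_eq_of_le hk with h | h
  · simp [tvF, permSt, triG, h, ha, h.ne]
  · simp [tvF, triG, h]

lemma tri_theta_self (q x : ℂ) : thetaH q (x / x) = 0 := by
  by_cases h : x = 0 <;> simp [thetaH, h]

lemma tri_next {n : ℕ} (J : Equiv.Perm (Fin n)) (π : (k : Fin n) → Equiv.Perm (Fin (k : ℕ)))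
    {k a : ℕ} (hk : k < n) (ha : a < k) :
    ∃ c, c < k + 1 ∧ triG n J π (k + 1) c = triG n J π k a := by
  have hm : triG n J π k a ∈ (Finset.range k).image (pval n J) := by
    simp only [triG, hk, ha, dif_pos]
    exact tri_mem J hk.le (Fin.is_lt _)
  have hm' : triG n J π k a ∈ (Finset.range (k + 1)).image (pval n J) :=
    Finset.image_subset_image (Finset.range_mono (Nat.le_succ k)) hm
  by_cases h : k + 1 < n
  · obtain ⟨b, hb, hbe⟩ := tri_surj J h.le hm'
    refine ⟨(π ⟨k + 1, h⟩).symm ⟨b, hb⟩, Fin.is_lt _, ?_⟩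
    rw [← hbe]
    simp only [triG, h, dif_pos, Fin.is_lt, Fin.eta, Equiv.apply_symm_apply]
  · refine ⟨triG n J π k a, ?_, by simp [triG, h]⟩
    simp only [Finset.mem_image, Finset.mem_range] at hm'
    obtain ⟨b, hb, hbe⟩ := hm'
    rw [← hbe]
    exact (tri_pval_lt J (by omega)).trans_le (by omega)

lemma tri_step {n : ℕ} (I J : Equiv.Perm (Fin n)) (π : (k : Fin n) → Equiv.Perm (Fin (k : ℕ)))
    (q sh : ℂ) (sμ sw : ℕ → ℂ)
    (hU : UF n I q sh sμ sw (permSt n π (fun k a => sw (ordIdx n J k a))) ≠ 0)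
    {k a c : ℕ} (hk : k < n) (ha : a < k) (hc : c < k + 1)
    (hg : triG n J π (k + 1) c = triG n J π k a) :
    ordIdx n I k a ≤ ordIdx n I (k + 1) c := by
  by_contra hlt
  push Not at hlt
  apply hU
  unfold UF
  apply Finset.prod_eq_zero (i := k) (Finset.mem_Icc.2 (by omega))
  apply mul_eq_zero_of_left
  apply Finset.prod_eq_zero (i := a) (Finset.mem_range.2 ha)
  apply Finset.prod_eq_zero (i := c) (Finset.mem_range.2 hc)
  rw [tri_tv J π sw hk hc, tri_tv J π sw hk.le ha, hg, psiF, if_pos hlt, tri_theta_self]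

lemma tri_all {n : ℕ} (I J : Equiv.Perm (Fin n)) (π : (k : Fin n) → Equiv.Perm (Fin (k : ℕ)))
    (q sh : ℂ) (sμ sw : ℕ → ℂ)
    (hU : UF n I q sh sμ sw (permSt n π (fun k a => sw (ordIdx n J k a))) ≠ 0)
    (d k a : ℕ) (hk : k + d = n) (ha : a < k) : ordIdx n I k a ≤ triG n J π k a := by
  induction d generalizing k a with
  | zero =>
    obtain rfl : k = n := by omega
    simpa [triG] using tri_top I (k - a - 1) a (by omega)
  | succ d ih =>
    obtain ⟨c, hc, hg⟩ := tri_next J π (show k < n by omega) ha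
    have h1 := tri_step I J π q sh sμ sw hU (by omega) ha hc hg
    have h2 := ih (k + 1) c (by omega) hc
    omega

lemma tri_prec {n : ℕ} (I J : Equiv.Perm (Fin n)) (π : (k : Fin n) → Equiv.Perm (Fin (k : ℕ)))
    (q sh : ℂ) (sμ sw : ℕ → ℂ)
    (hU : UF n I q sh sμ sw (permSt n π (fun k a => sw (ordIdx n J k a))) ≠ 0) :
    prec n I J := by
  intro k hk1 hkn m hm
  have hk : k < n := by omega
  by_contra hlt
  push Not at hlt
  have key : ∀ a : Fin k, a ∈ Finset.Ici (⟨m, hm⟩ : Fin k) →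
      (π ⟨k, hk⟩) a ∈ Finset.Ioi (⟨m, hm⟩ : Fin k) := by
    intro a ha
    rw [Finset.mem_Ici] at ha
    rw [Finset.mem_Ioi]
    have ha' : m ≤ (a : ℕ) := ha
    have h1 := tri_all I J π q sh sμ sw hU (n - k) k a (by omega) a.2
    simp only [triG, hk, a.2, dif_pos, Fin.eta] at h1
    have h2 : ordIdx n I k m ≤ ordIdx n I k a := by
      rcases Nat.lt_or_eq_of_le ha' with h | h
      · exact (tri_lt I hk.le h a.2).le
      · rw [h]
    by_contra hcon
    have hcon' : ((π ⟨k, hk⟩ a : Fin k) : ℕ) ≤ m := not_lt.1 hcon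
    have h3 : ordIdx n J k ((π ⟨k, hk⟩ a : Fin k) : ℕ) ≤ ordIdx n J k m := by
      rcases Nat.lt_or_eq_of_le hcon' with h | h
      · exact (tri_lt J hk.le h hm).le
      · rw [h]
    omega
  have := Finset.card_le_card_of_injOn _ key ((π ⟨k, hk⟩).injective.injOn)
  rw [Fin.card_Ici, Fin.card_Ioi] at this
  simp only at this
  omega

/-- Lemma 2.4 of [RTV] / Lemma `stabt` of the paper: the elliptic weight function
`W_I`, evaluated at `t = w_J` (i.e. `t^{(k)}_a = w_{j^{(k)}_a}`), vanishes unless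
`I ≺ J`.  All parameters carry fixed square roots (`sq, sh, sμ j, sw i` are the roots
of `q, ħ, μ_{j+1}, w_{i+1}`), and the parameters are generic in the sense that all
theta denominators appearing in the weight function are nonzero. -/
theorem weight_function_triangularity
    (n : ℕ) (hn : 1 ≤ n) (I J : Equiv.Perm (Fin n))
    (q sq h sh : ℂ) (sμ sw : ℕ → ℂ)
    (hq0 : 0 < ‖q‖) (hq1 : ‖q‖ < 1)
    (hsq : sq ^ 2 = q) (hsh : sh ^ 2 = h)
    (hden1 : ∀ j k, j < n → k < n → j ≠ k →
      thetaH q (sh⁻¹ * sμ j / sμ k) ≠ 0 ∧ thetaH q (sμ j / sμ k) ≠ 0)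
    (hden2 : ∀ i j, i < n → j < n → i ≠ j → thetaH q (sw i / sw j) ≠ 0)
    (hprec : ¬ prec n I J) :
    WF n I q sh sμ sw (fun k a => sw (ordIdx n J k a)) = 0 := by
  unfold WF
  apply mul_eq_zero_of_right
  apply Finset.sum_eq_zero
  intro π _
  by_contra hU
  exact hprec (tri_prec I J π q sh sμ sw hU)
end
end

section
/- Let n ≥ 1 and let I be a permutation of {1,…,n}. Then the normalized elliptic weight function W̃_I = W_I/E evaluated at t = w_I (i.e. t^{(k)}_a = w_{i^{(k)}_a} for all k, a) equals P_I(w,ħ) = ∏_{1≤k<l≤n, I_l<I_k} ϑ(w_{I_k}/w_{I_l}) · ∏_{1≤k<l≤n, I_k<I_l} ϑ(ħ w_{I_k}/w_{I_l}), at generic parameter values where E and all theta denominators are nonzero. -/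
noncomputable section
open scoped BigOperators

theorem thetaH_zero (q : ℂ) : thetaH q 0 = 0 := by simp [thetaH]

theorem thetaH_one (q : ℂ) : thetaH q 1 = 0 := by simp [thetaH]

theorem thetaH_inv (q y : ℂ) : thetaH q y⁻¹ = - thetaH q y := by
  unfold thetaH
  have h1 : q * y⁻¹ ^ 2 = q / y ^ 2 := by rw [inv_pow]; rfl
  have h2 : q / y⁻¹ ^ 2 = q * y ^ 2 := by rw [inv_pow, div_inv_eq_mul]
  rw [h1, h2, inv_inv]; ring

/-- the set of the first `k` values. -/
def SS (n : ℕ) (I : Equiv.Perm (Fin n)) (k : ℕ) : Finset ℕ :=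
  (Finset.range k).image (pval n I)

theorem pval_injOn (n : ℕ) (I : Equiv.Perm (Fin n)) {j k : ℕ} (hj : j < n) (hk : k < n)
    (h : pval n I j = pval n I k) : j = k := by
  simp only [pval, hj, hk, dif_pos] at h
  have := I.injective (Fin.ext h)
  simpa using this

theorem pval_lt (n : ℕ) (I : Equiv.Perm (Fin n)) {j : ℕ} (hj : j < n) : pval n I j < n := by
  simp [pval, hj]

theorem injOn_range (n : ℕ) (I : Equiv.Perm (Fin n)) {k : ℕ} (hk : k ≤ n) :
    Set.InjOn (pval n I) (Finset.range k : Set ℕ) := by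
  intro a ha b hb h
  simp at ha hb
  exact pval_injOn n I (by omega) (by omega) h

theorem card_SS (n : ℕ) (I : Equiv.Perm (Fin n)) {k : ℕ} (hk : k ≤ n) : (SS n I k).card = k := by
  rw [SS, Finset.card_image_of_injOn (injOn_range n I hk), Finset.card_range]

theorem SS_lt (n : ℕ) (I : Equiv.Perm (Fin n)) {k v : ℕ} (hk : k ≤ n) (hv : v ∈ SS n I k) :
    v < n := by
  simp only [SS, Finset.mem_image, Finset.mem_range] at hv
  obtain ⟨a, ha, rfl⟩ := hv
  exact pval_lt n I (by omega)

theorem SS_succ (n : ℕ) (I : Equiv.Perm (Fin n)) (k : ℕ) :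
    SS n I (k+1) = insert (pval n I k) (SS n I k) := by
  simp [SS, Finset.range_add_one, Finset.image_insert]

theorem pval_notMem (n : ℕ) (I : Equiv.Perm (Fin n)) {k : ℕ} (hk : k < n) :
    pval n I k ∉ SS n I k := by
  simp only [SS, Finset.mem_image, Finset.mem_range, not_exists, not_and]
  intro j hj h
  have := pval_injOn n I (by omega) hk h
  omega

theorem SS_full (n : ℕ) (I : Equiv.Perm (Fin n)) : SS n I n = Finset.range n := by
  apply Finset.eq_of_subset_of_card_le
  · intro v hv
    simpa using SS_lt n I le_rfl hv
  · rw [card_SS n I le_rfl, Finset.card_range]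

theorem ordIdx_eq (n : ℕ) (I : Equiv.Perm (Fin n)) {k a : ℕ} (hk : k ≤ n) (ha : a < k) :
    ∃ h : a < ((SS n I k).sort (· ≤ ·)).length,
    ordIdx n I k a = ((SS n I k).sort (· ≤ ·))[a] := by
  have h : a < ((SS n I k).sort (· ≤ ·)).length := by
    rw [Finset.length_sort, card_SS n I hk]; exact ha
  exact ⟨h, List.getD_eq_getElem _ _ h⟩

theorem ordIdx_mem (n : ℕ) (I : Equiv.Perm (Fin n)) {k a : ℕ} (hk : k ≤ n) (ha : a < k) :
    ordIdx n I k a ∈ SS n I k := by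
  obtain ⟨h, e⟩ := ordIdx_eq n I hk ha
  rw [e, ← Finset.mem_sort (· ≤ ·)]
  exact List.getElem_mem h

theorem ordIdx_lt (n : ℕ) (I : Equiv.Perm (Fin n)) {k a b : ℕ} (hk : k ≤ n) (hb : b < k)
    (hab : a < b) : ordIdx n I k a < ordIdx n I k b := by
  obtain ⟨h, e⟩ := ordIdx_eq n I hk hb
  obtain ⟨h', e'⟩ := ordIdx_eq n I hk (hab.trans hb)
  rw [e, e']
  exact List.pairwise_iff_getElem.1 (Finset.sortedLT_sort (SS n I k)).pairwise _ _ _ _ hab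

theorem ordIdx_lt_iff (n : ℕ) (I : Equiv.Perm (Fin n)) {k a b : ℕ} (hk : k ≤ n) (ha : a < k)
    (hb : b < k) : ordIdx n I k a < ordIdx n I k b ↔ a < b := by
  constructor
  · intro h
    by_contra h'
    rcases (not_lt.1 h').lt_or_eq with h2 | h2
    · exact absurd (ordIdx_lt n I hk ha h2) (by omega)
    · subst h2; omega
  · exact ordIdx_lt n I hk hb

theorem ordIdx_inj (n : ℕ) (I : Equiv.Perm (Fin n)) {k : ℕ} (hk : k ≤ n) :
    Set.InjOn (ordIdx n I k) (Finset.range k : Set ℕ) := by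
  intro a ha b hb h
  simp at ha hb
  rcases lt_trichotomy a b with h1 | h1 | h1
  · have := ordIdx_lt n I hk hb h1; omega
  · exact h1
  · have := ordIdx_lt n I hk ha h1; omega

theorem image_ordIdx (n : ℕ) (I : Equiv.Perm (Fin n)) {k : ℕ} (hk : k ≤ n) :
    (Finset.range k).image (ordIdx n I k) = SS n I k := by
  apply Finset.eq_of_subset_of_card_le
  · intro v hv
    simp only [Finset.mem_image, Finset.mem_range] at hv
    obtain ⟨a, ha, rfl⟩ := hv
    exact ordIdx_mem n I hk ha
  · rw [card_SS n I hk, Finset.card_image_of_injOn (ordIdx_inj n I hk), Finset.card_range]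

theorem prod_ordIdx (n : ℕ) (I : Equiv.Perm (Fin n)) {k : ℕ} (hk : k ≤ n) (f : ℕ → ℂ) :
    ∏ a ∈ Finset.range k, f (ordIdx n I k a) = ∏ v ∈ SS n I k, f v := by
  rw [← image_ordIdx n I hk, Finset.prod_image (ordIdx_inj n I hk)]

theorem ordIdx_full (n : ℕ) (I : Equiv.Perm (Fin n)) {a : ℕ} (ha : a < n) :
    ordIdx n I n a = a := by
  obtain ⟨h, e⟩ := ordIdx_eq n I le_rfl ha
  rw [e]
  simp [SS_full, Finset.sort_range]

theorem perm_exists_lt {k : ℕ} (π : Equiv.Perm (Fin k)) (h : π ≠ 1) : ∃ a, π a < a := by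
  by_contra hc
  push Not at hc
  apply h
  have hs : ∑ a : Fin k, (a : ℕ) = ∑ a : Fin k, ((π a : Fin k) : ℕ) :=
    (Equiv.sum_comp π (fun a : Fin k => (a : ℕ))).symm
  have := (Finset.sum_eq_sum_iff_of_le (fun a _ => (Fin.le_def.1 (hc a)))).1 hs
  ext a
  exact (this a (Finset.mem_univ a)).symm

theorem UF_vanish (n : ℕ) (I : Equiv.Perm (Fin n)) (q sh : ℂ) (sμ sw : ℕ → ℂ)
    (π : (k : Fin n) → Equiv.Perm (Fin (k : ℕ))) (hπ : π ≠ 1) :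
    UF n I q sh sμ sw (permSt n π (fun k a => sw (ordIdx n I k a))) = 0 := by
  classical
  have hne : ((Finset.univ : Finset (Fin n)).filter (fun k => π k ≠ 1)).Nonempty := by
    by_contra hc
    rw [Finset.not_nonempty_iff_eq_empty, Finset.filter_eq_empty_iff] at hc
    apply hπ
    funext k
    simpa using hc (Finset.mem_univ k)
  obtain ⟨k, hk, hmax⟩ := Finset.exists_max_image _ id hne
  simp only [Finset.mem_filter, Finset.mem_univ, true_and, id] at hk hmax
  obtain ⟨k, hkn⟩ := k
  obtain ⟨a, ha⟩ := perm_exists_lt (π ⟨k, hkn⟩) hk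
  obtain ⟨a, hak⟩ := a
  simp only at hak
  have hS : ordIdx n I k (π ⟨k, hkn⟩ ⟨a, hak⟩ : Fin k) ∈ SS n I (k+1) := by
    rw [SS_succ]
    exact Finset.mem_insert_of_mem (ordIdx_mem n I hkn.le (Fin.is_lt _))
  rw [← image_ordIdx n I (by omega)] at hS
  simp only [Finset.mem_image, Finset.mem_range] at hS
  obtain ⟨c, hc, hce⟩ := hS
  have hlt : ordIdx n I (k+1) c < ordIdx n I k a := by
    rw [hce]; exact ordIdx_lt n I hkn.le hak ha
  have htop : tvF n sw (permSt n π (fun k a => sw (ordIdx n I k a))) (k+1) c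
      = sw (ordIdx n I (k+1) c) := by
    unfold tvF
    split_ifs with h
    · subst h; rw [ordIdx_full _ I hc]
    · have hk1 : k + 1 < n := by omega
      have h1 : π ⟨k+1, hk1⟩ = 1 := by
        by_contra h2
        have := hmax _ h2
        simp [Fin.le_def] at this
      simp [permSt, hk1, hc, h1]
  have hbot : tvF n sw (permSt n π (fun k a => sw (ordIdx n I k a))) k a
      = sw (ordIdx n I (k+1) c) := by
    unfold tvF
    rw [if_neg (by omega), hce]
    simp [permSt, hkn, hak]
  unfold UF
  apply Finset.prod_eq_zero (i := k) (by simp; omega)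
  apply mul_eq_zero_of_left
  apply Finset.prod_eq_zero (i := a) (by simpa using hak)
  apply Finset.prod_eq_zero (i := c) (by simpa using hc)
  rw [htop, hbot, psiF, if_pos hlt]
  by_cases h0 : sw (ordIdx n I (k+1) c) = 0
  · simp [h0, thetaH_zero]
  · rw [div_self h0, thetaH_one]

theorem level_identity (q sh : ℂ) (sw : ℕ → ℂ) (S : Finset ℕ) (u0 : ℕ) (hu0 : u0 ∉ S)
    (hsw : ∀ u ∈ S, sw u ≠ 0)
    (hden : ∀ u ∈ S, ∀ v ∈ S, u ≠ v → thetaH q (sw u / sw v) ≠ 0) :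
    thetaH q sh⁻¹ ^ S.card *
    ((∏ u ∈ S, ∏ v ∈ insert u0 S, (if v < u then thetaH q (sw v / sw u) else
        if v = u then 1 else thetaH q (sw v / sw u / sh))) *
      ∏ u ∈ S, ∏ v ∈ S, (if u < v then
        thetaH q (sh * sw v / sw u) / thetaH q (sw v / sw u) else 1)) =
    (∏ u ∈ S, ∏ v ∈ S, thetaH q (sh * sw v / sw u)) *
      ∏ u ∈ S, (if u0 < u then thetaH q (sw u / sw u0) else thetaH q (sh * sw u / sw u0)) := by
  have e1 : ∀ u v : ℕ, thetaH q (sw v / sw u) = - thetaH q (sw u / sw v) := by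
    intro u v; rw [← thetaH_inv, inv_div]
  have e2 : ∀ u v : ℕ, thetaH q (sw v / sw u / sh) = - thetaH q (sh * sw u / sw v) := by
    intro u v; rw [← thetaH_inv]; congr 1; rw [inv_div, div_div, mul_comm]
  have A : ∏ u ∈ S, ∏ v ∈ insert u0 S, (if v < u then thetaH q (sw v / sw u) else
        if v = u then 1 else thetaH q (sw v / sw u / sh)) =
      (-1) ^ S.card * (∏ u ∈ S, (if u0 < u then thetaH q (sw u / sw u0)
          else thetaH q (sh * sw u / sw u0))) *
       ((∏ u ∈ S, ∏ v ∈ S, (if u < v then thetaH q (sw u / sw v) else 1)) *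
        ∏ u ∈ S, ∏ v ∈ S, (if u < v then thetaH q (sw v / sw u / sh) else 1)) := by
    rw [Finset.prod_comm (f := fun u v => (if u < v then thetaH q (sw u / sw v) else 1)),
      ← Finset.prod_const, ← Finset.prod_mul_distrib, ← Finset.prod_mul_distrib,
      ← Finset.prod_mul_distrib]
    apply Finset.prod_congr rfl
    intro u hu
    rw [Finset.prod_insert hu0, ← Finset.prod_mul_distrib]
    congr 1
    · have : u0 ≠ u := fun h => hu0 (h ▸ hu)
      rw [if_neg this, e1, e2]
      split_ifs <;> ring
    · apply Finset.prod_congr rfl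
      intro v hv
      rcases lt_trichotomy u v with h | h | h
      · simp [h, h.not_gt, h.ne']
      · simp [h]
      · simp [h, h.not_gt]
  have B : (∏ u ∈ S, ∏ v ∈ S, thetaH q (sh * sw v / sw u)) =
      thetaH q sh ^ S.card *
      ((∏ u ∈ S, ∏ v ∈ S, (if u < v then thetaH q (sh * sw u / sw v) else 1)) *
       (∏ u ∈ S, ∏ v ∈ S, (if u < v then thetaH q (sh * sw v / sw u) else 1))) := by
    rw [Finset.prod_comm (f := fun u v => (if u < v then thetaH q (sh * sw u / sw v) else 1)),
      ← Finset.prod_const, ← Finset.prod_mul_distrib, ← Finset.prod_mul_distrib]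
    apply Finset.prod_congr rfl
    intro u hu
    have : thetaH q sh = ∏ v ∈ S, (if v = u then thetaH q sh else 1) := by
      simp [Finset.prod_ite_eq', hu]
    rw [this, ← Finset.prod_mul_distrib, ← Finset.prod_mul_distrib]
    apply Finset.prod_congr rfl
    intro v hv
    rcases lt_trichotomy u v with h | h | h
    · simp [h, h.not_gt, h.ne']
    · subst h; simp [mul_div_assoc, div_self (hsw u hu)]
    · simp [h, h.not_gt, h.ne]
  have C : (∏ u ∈ S, ∏ v ∈ S, (if u < v then thetaH q (sw u / sw v) else 1)) *
        (∏ u ∈ S, ∏ v ∈ S, (if u < v then thetaH q (sw v / sw u / sh) else 1)) *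
        (∏ u ∈ S, ∏ v ∈ S, (if u < v then
        thetaH q (sh * sw v / sw u) / thetaH q (sw v / sw u) else 1)) =
      (∏ u ∈ S, ∏ v ∈ S, (if u < v then thetaH q (sh * sw u / sw v) else 1)) *
       (∏ u ∈ S, ∏ v ∈ S, (if u < v then thetaH q (sh * sw v / sw u) else 1)) := by
    simp only [← Finset.prod_mul_distrib]
    refine Finset.prod_congr rfl fun u hu => Finset.prod_congr rfl fun v hv => ?_
    by_cases h : u < v
    · simp only [h, if_true]
      have hd := hden u hu v hv h.ne
      rw [e1 u v, e2]
      field_simp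
    · simp [h]
  rw [A, B, ← C, thetaH_inv, neg_pow]
  have : ((-1 : ℂ) ^ S.card) * (-1) ^ S.card = 1 := by
    rw [← mul_pow]; simp
  linear_combination (thetaH q sh ^ S.card * (∏ u ∈ S, (if u0 < u then thetaH q (sw u / sw u0)
          else thetaH q (sh * sw u / sw u0))) *
    ((∏ u ∈ S, ∏ v ∈ S, (if u < v then thetaH q (sw u / sw v) else 1)) *
        (∏ u ∈ S, ∏ v ∈ S, (if u < v then thetaH q (sw v / sw u / sh) else 1)) *
        (∏ u ∈ S, ∏ v ∈ S, (if u < v then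
        thetaH q (sh * sw v / sw u) / thetaH q (sw v / sw u) else 1)))) * this

theorem tvF_diag (n : ℕ) (I : Equiv.Perm (Fin n)) (sw : ℕ → ℂ) {k a : ℕ} (ha : a < k) :
    tvF n sw (fun k a => sw (ordIdx n I k a)) k a = sw (ordIdx n I k a) := by
  unfold tvF
  split_ifs with h
  · subst h; rw [ordIdx_full _ I ha]
  · rfl

theorem permSt_one (n : ℕ) (st : ℕ → ℕ → ℂ) : permSt n 1 st = st := by
  funext k a
  simp [permSt]

theorem jIdx_lt (n : ℕ) (I : Equiv.Perm (Fin n)) {k a : ℕ} (hk : k ≤ n) (ha : a < k) :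
    jIdx n I k a < k := by
  have h := ordIdx_mem n I hk ha
  have hl := SS_lt n I hk h
  simp only [SS, Finset.mem_image, Finset.mem_range] at h
  obtain ⟨j, hj, e⟩ := h
  have hjn : j < n := by omega
  have : I.symm ⟨ordIdx n I k a, hl⟩ = ⟨j, hjn⟩ := by
    rw [Equiv.symm_apply_eq]
    ext
    simp [← e, pval, hjn]
  simp [jIdx, hl, this, hj]

/-- Lemma 2.5 of [RTV] / Lemma `rtv2` of the paper: the normalized weight function
`W̃_I = W_I/E`, evaluated at `t = w_I`, equals
`P_I(w,ħ) = ∏_{k<l, I_l<I_k} ϑ(w_{I_k}/w_{I_l}) ∏_{k<l, I_k<I_l} ϑ(ħ w_{I_k}/w_{I_l})`.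
All parameters carry fixed square roots, and the parameter values are generic: `E` and
every theta denominator appearing is nonzero. -/
theorem weight_function_diagonal
    (n : ℕ) (hn : 1 ≤ n) (I : Equiv.Perm (Fin n))
    (q sq h sh : ℂ) (sμ sw : ℕ → ℂ)
    (hq0 : 0 < ‖q‖) (hq1 : ‖q‖ < 1)
    (hsq : sq ^ 2 = q) (hsh : sh ^ 2 = h)
    (hden1 : ∀ j k, j < n → k < n → j ≠ k →
      thetaH q (sh⁻¹ * sμ j / sμ k) ≠ 0 ∧ thetaH q (sμ j / sμ k) ≠ 0)
    (hden2 : ∀ i j, i < n → j < n → i ≠ j → thetaH q (sw i / sw j) ≠ 0)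
    (hE : EF n q sh sw (fun k a => sw (ordIdx n I k a)) ≠ 0) :
    WF n I q sh sμ sw (fun k a => sw (ordIdx n I k a)) /
        EF n q sh sw (fun k a => sw (ordIdx n I k a)) =
      ∏ p ∈ pairsN n,
        (if pval n I p.2 < pval n I p.1 then thetaH q (sw (pval n I p.1) / sw (pval n I p.2))
         else thetaH q (sh * sw (pval n I p.1) / sw (pval n I p.2))) := by
  classical
  have hW : WF n I q sh sμ sw (fun k a => sw (ordIdx n I k a)) =
      thetaH q sh⁻¹ ^ (n * (n - 1) / 2) *
        UF n I q sh sμ sw (fun k a => sw (ordIdx n I k a)) := by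
    unfold WF
    congr 1
    rw [Finset.sum_eq_single 1 (fun π _ h => UF_vanish n I q sh sμ sw π h) (by simp), permSt_one]
  rw [div_eq_iff hE, hW]
  have hsw : ∀ i j, i < n → j < n → i ≠ j → sw i ≠ 0 := by
    intro i j hi hj hij h0
    exact hden2 i j hi hj hij (by simp [h0, thetaH_zero])
  have hdeg : n * (n - 1) / 2 = ∑ k ∈ Finset.Icc 1 (n - 1), k := by
    rw [← Finset.sum_range_id, Finset.range_eq_Ico, Finset.sum_eq_sum_Ico_succ_bot (by omega)]
    rw [zero_add]
    apply Finset.sum_congr _ (fun _ _ => rfl)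
    ext x; simp; omega
  have hP : ∏ p ∈ pairsN n,
        (if pval n I p.2 < pval n I p.1 then thetaH q (sw (pval n I p.1) / sw (pval n I p.2))
         else thetaH q (sh * sw (pval n I p.1) / sw (pval n I p.2))) =
      ∏ k ∈ Finset.Icc 1 (n - 1), ∏ u ∈ SS n I k,
        (if pval n I k < u then thetaH q (sw u / sw (pval n I k))
         else thetaH q (sh * sw u / sw (pval n I k))) := by
    symm
    have : ∀ k ∈ Finset.Icc 1 (n-1), ∏ u ∈ SS n I k,
        (if pval n I k < u then thetaH q (sw u / sw (pval n I k))
         else thetaH q (sh * sw u / sw (pval n I k))) = ∏ j ∈ Finset.range k, 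
        (if pval n I k < pval n I j then thetaH q (sw (pval n I j) / sw (pval n I k))
         else thetaH q (sh * sw (pval n I j) / sw (pval n I k))) := by
      intro k hk
      rw [Finset.mem_Icc] at hk
      rw [SS, Finset.prod_image (injOn_range n I (by omega))]
    rw [Finset.prod_congr rfl this, Finset.prod_sigma']
    refine Finset.prod_bij' (fun x _ => (x.2, x.1)) (fun p _ => ⟨p.2, p.1⟩) ?_ ?_ ?_ ?_ ?_
    · rintro ⟨k, j⟩ h
      simp [pairsN] at h ⊢
      omega
    · rintro ⟨j, k⟩ h
      simp [pairsN] at h ⊢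
      omega
    · intros; rfl
    · intros; rfl
    · intros; rfl
  rw [hdeg, ← Finset.prod_pow_eq_pow_sum, hP, UF, EF, ← Finset.prod_mul_distrib,
    ← Finset.prod_mul_distrib]
  apply Finset.prod_congr rfl
  intro k hk
  rw [Finset.mem_Icc] at hk
  have hkn : k < n := by omega
  have hswS : ∀ u, u < n → sw u ≠ 0 := by
    intro u hu
    by_cases h : u = 0
    · exact hsw u 1 hu (by omega) (by omega)
    · exact hsw u 0 hu (by omega) h
  have key := level_identity q sh sw (SS n I k) (pval n I k) (pval_notMem n I hkn)
    (fun u hu => hswS u (SS_lt n I hkn.le hu))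
    (fun u hu v hv => hden2 u v (SS_lt n I hkn.le hu) (SS_lt n I hkn.le hv))
  rw [card_SS n I hkn.le, ← SS_succ] at key
  have h1 : (∏ a ∈ Finset.range k, ∏ c ∈ Finset.range (k + 1),
        psiF n I q sh sμ k a c (tvF n sw (fun k a => sw (ordIdx n I k a)) (k + 1) c /
          tvF n sw (fun k a => sw (ordIdx n I k a)) k a)) =
      ∏ u ∈ SS n I k, ∏ v ∈ SS n I (k+1), (if v < u then thetaH q (sw v / sw u) else
        if v = u then 1 else thetaH q (sw v / sw u / sh)) := by
    rw [← prod_ordIdx n I hkn.le (fun u => ∏ v ∈ SS n I (k+1),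
      (if v < u then thetaH q (sw v / sw u) else
        if v = u then 1 else thetaH q (sw v / sw u / sh)))]
    apply Finset.prod_congr rfl
    intro a ha
    rw [Finset.mem_range] at ha
    rw [← prod_ordIdx n I (k := k+1) hkn (fun v =>
      (if v < ordIdx n I k a then thetaH q (sw v / sw (ordIdx n I k a)) else
        if v = ordIdx n I k a then 1 else thetaH q (sw v / sw (ordIdx n I k a) / sh)))]
    apply Finset.prod_congr rfl
    intro c hc
    rw [Finset.mem_range] at hc
    rw [tvF_diag n I sw ha, tvF_diag n I sw hc, psiF]
    split_ifs with g1 g2 g3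
    · rfl
    · have hj := jIdx_lt n I hkn.le ha
      rw [g2, div_self (hswS _ (SS_lt n I hkn.le (ordIdx_mem n I hkn.le ha))), one_mul]
      exact div_self (hden1 _ k (by omega) hkn (by omega)).1
    · have hj := jIdx_lt n I hkn.le ha
      rw [g2, div_self (hswS _ (SS_lt n I hkn.le (ordIdx_mem n I hkn.le ha))), one_mul, one_mul]
      exact div_self (hden1 _ k (by omega) hkn (by omega)).2
    · rfl
  have h2 : (∏ a ∈ Finset.range k, ∏ b ∈ Finset.Ioo a k,
        thetaH q (sh * tvF n sw (fun k a => sw (ordIdx n I k a)) k b /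
            tvF n sw (fun k a => sw (ordIdx n I k a)) k a) /
          thetaH q (tvF n sw (fun k a => sw (ordIdx n I k a)) k b /
            tvF n sw (fun k a => sw (ordIdx n I k a)) k a)) =
      ∏ u ∈ SS n I k, ∏ v ∈ SS n I k, (if u < v then
        thetaH q (sh * sw v / sw u) / thetaH q (sw v / sw u) else 1) := by
    rw [← prod_ordIdx n I hkn.le (fun u => ∏ v ∈ SS n I k, (if u < v then
        thetaH q (sh * sw v / sw u) / thetaH q (sw v / sw u) else 1))]
    apply Finset.prod_congr rfl
    intro a ha
    rw [Finset.mem_range] at ha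
    rw [← prod_ordIdx n I hkn.le (fun v => (if ordIdx n I k a < v then
        thetaH q (sh * sw v / sw (ordIdx n I k a)) /
          thetaH q (sw v / sw (ordIdx n I k a)) else 1))]
    have hI : Finset.Ioo a k = (Finset.range k).filter (fun b => a < b) := by
      ext b; simp; omega
    rw [hI, Finset.prod_filter]
    apply Finset.prod_congr rfl
    intro b hb
    rw [Finset.mem_range] at hb
    rw [tvF_diag n I sw ha, tvF_diag n I sw hb]
    simp only [ordIdx_lt_iff n I hkn.le ha hb]
  have h3 : (∏ a ∈ Finset.range k, ∏ b ∈ Finset.range k,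
      thetaH q (sh * tvF n sw (fun k a => sw (ordIdx n I k a)) k b /
        tvF n sw (fun k a => sw (ordIdx n I k a)) k a)) =
      ∏ u ∈ SS n I k, ∏ v ∈ SS n I k, thetaH q (sh * sw v / sw u) := by
    rw [← prod_ordIdx n I hkn.le (fun u => ∏ v ∈ SS n I k, thetaH q (sh * sw v / sw u))]
    apply Finset.prod_congr rfl
    intro a ha
    rw [Finset.mem_range] at ha
    rw [← prod_ordIdx n I hkn.le (fun v => thetaH q (sh * sw v / sw (ordIdx n I k a)))]
    apply Finset.prod_congr rfl
    intro b hb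
    rw [Finset.mem_range] at hb
    rw [tvF_diag n I sw ha, tvF_diag n I sw hb]
  rw [h1, h2, h3, key, mul_comm]
end
end
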